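/- arXiv:2507.08433 — 2 statements merged into one kernel-verified Lean document; each statement's English description precedes it below -/
import Mathlib

section
/- Let d ≥ 2 be an integer and let T_d be the complete binary tree of height d. For every integer j with 1 ≤ j ≤ d, the set S consisting of all vertices at distance at most j − 1 from the root is a 2^j-multiset antiresolving set of T_d of cardinality 2^j − 1 = Σ_{i=1}^{j} 2^{i−1}; in particular msad_{2^j}(T_d) ≤ 2^j − 1. -/
open Finset

/-- The multiset representation of `v` with respect to `S`:
the multiset of distances from `v` to the vertices of `S`, counted with multiplicity. -/
noncomputable def mrep {V : Type*} (G : SimpleGraph V) (S : Finset V) (v : V) : Multiset ℕ :=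
  S.val.map (fun s => G.dist v s)

open scoped Classical in
/-- The set of vertices outside `S` having the same multiset representation as `u`. -/
noncomputable def mclass {V : Type*} [Fintype V] (G : SimpleGraph V) (S : Finset V)
    (u : V) : Finset V :=
  Finset.univ.filter (fun v => v ∉ S ∧ mrep G S v = mrep G S u)

open scoped Classical in
/-- `S` is a `k`-multiset antiresolving set (`k`-MARS) of `G`: `S` is nonempty, its complement
is nonempty, and `k` is the largest integer such that every vertex `u ∉ S` has at least `k`
vertices outside `S` (including itself) with its same multiset representation. -/
def IsMARS {V : Type*} [Fintype V] (G : SimpleGraph V) (S : Finset V) (k : ℕ) : Prop :=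
  S.Nonempty ∧ Sᶜ.Nonempty ∧
    (∀ u ∉ S, k ≤ (mclass G S u).card) ∧ (∃ u ∉ S, (mclass G S u).card = k)

/-- The complete binary tree of height `d`, with vertices indexed heap-style by
`0, 1, ..., 2^(d+1) - 2`: the root is `0` and vertex `i` is adjacent to its children
`2i + 1` and `2i + 2` (when they exist), so every leaf is at distance `d` from the root. -/
def binTree (d : ℕ) : SimpleGraph (Fin (2 ^ (d + 1) - 1)) :=
  SimpleGraph.fromRel (fun u v => (v : ℕ) = 2 * (u : ℕ) + 1 ∨ (v : ℕ) = 2 * (u : ℕ) + 2)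

/-- The root of the complete binary tree of height `d`. -/
def binRoot (d : ℕ) : Fin (2 ^ (d + 1) - 1) :=
  ⟨0, by have h : 1 < 2 ^ (d + 1) := Nat.one_lt_two_pow_iff.mpr (by omega); omega⟩

namespace BinTree

/-! ### Flipping branches of the tree, on the labels `v + 1` -/

theorem log_xor_of_lt {n x : ℕ} (hn : n ≠ 0) (hx : x < 2 ^ Nat.log 2 n) :
    n ^^^ x ≠ 0 ∧ Nat.log 2 (n ^^^ x) = Nat.log 2 n := by
  have hlo : 2 ^ Nat.log 2 n ≤ n ^^^ x := by
    by_contra! h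
    have h' := Nat.xor_lt_two_pow h hx
    rw [Nat.xor_assoc, Nat.xor_self, Nat.xor_zero] at h'
    exact absurd (Nat.pow_log_le_self 2 hn) (by omega)
  have hhi : n ^^^ x < 2 ^ (Nat.log 2 n + 1) :=
    Nat.xor_lt_two_pow (Nat.lt_pow_succ_log_self one_lt_two n)
      (hx.trans (Nat.pow_lt_pow_right one_lt_two (Nat.lt_succ_self _)))
  have hpos := Nat.two_pow_pos (Nat.log 2 n)
  exact ⟨by omega, Nat.log_eq_of_pow_le_of_lt_pow hlo hhi⟩

/-- Regard `n` as a leading `1` followed by a path from the root, and flip this path by the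
corresponding initial segment of the `d`-bit mask `m`. -/
def flip (d m n : ℕ) : ℕ := n ^^^ (m / 2 ^ (d - Nat.log 2 n))

variable {d m n : ℕ}

theorem mask_lt (hm : m < 2 ^ d) (hn : Nat.log 2 n ≤ d) :
    m / 2 ^ (d - Nat.log 2 n) < 2 ^ Nat.log 2 n := by
  rw [Nat.div_lt_iff_lt_mul (Nat.two_pow_pos _), ← pow_add]
  rwa [Nat.add_sub_cancel' hn]

theorem flip_ne_zero (hm : m < 2 ^ d) (h0 : n ≠ 0) (hn : Nat.log 2 n ≤ d) : flip d m n ≠ 0 :=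
  (log_xor_of_lt h0 (mask_lt hm hn)).1

theorem log_flip (hm : m < 2 ^ d) (h0 : n ≠ 0) (hn : Nat.log 2 n ≤ d) :
    Nat.log 2 (flip d m n) = Nat.log 2 n :=
  (log_xor_of_lt h0 (mask_lt hm hn)).2

theorem flip_flip (hm : m < 2 ^ d) (h0 : n ≠ 0) (hn : Nat.log 2 n ≤ d) :
    flip d m (flip d m n) = n := by
  rw [flip, log_flip hm h0 hn, flip, Nat.xor_assoc, Nat.xor_self, Nat.xor_zero]

theorem flip_div_two (h2 : 2 ≤ n) (hn : Nat.log 2 n ≤ d) :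
    flip d m n / 2 = flip d m (n / 2) := by
  have h1 : 1 ≤ Nat.log 2 n := Nat.log_pos one_lt_two h2
  rw [flip, flip, Nat.xor_div_two, Nat.log_div_base, Nat.div_div_eq_div_mul, ← pow_succ]
  congr 3
  omega

theorem exists_flip_eq {a b : ℕ} (ha : a ≠ 0) (hb : b ≠ 0) (had : Nat.log 2 a ≤ d)
    (hab : Nat.log 2 a = Nat.log 2 b) : ∃ m < 2 ^ d, flip d m a = b := by
  set l := Nat.log 2 a with hl
  have hx : a ^^^ b < 2 ^ l := by
    have ha1 : a / 2 ^ l = 1 := by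
      have h1 := Nat.pow_log_le_self 2 ha
      have h2 := Nat.lt_pow_succ_log_self one_lt_two a
      rw [← hl] at h1 h2
      exact Nat.div_eq_of_lt_le (by omega) (by rw [pow_succ] at h2; omega)
    have hb1 : b / 2 ^ l = 1 := by
      have h1 := Nat.pow_log_le_self 2 hb
      have h2 := Nat.lt_pow_succ_log_self one_lt_two b
      rw [← hab] at h1 h2
      exact Nat.div_eq_of_lt_le (by omega) (by rw [pow_succ] at h2; omega)
    have h : (a ^^^ b) / 2 ^ l = 0 := by rw [Nat.xor_div_two_pow, ha1, hb1, Nat.xor_self]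
    exact (Nat.div_eq_zero_iff.mp h).resolve_left (Nat.two_pow_pos l).ne'
  refine ⟨(a ^^^ b) * 2 ^ (d - l), ?_, ?_⟩
  · calc (a ^^^ b) * 2 ^ (d - l) < 2 ^ l * 2 ^ (d - l) :=
          Nat.mul_lt_mul_of_pos_right hx (Nat.two_pow_pos _)
      _ = 2 ^ d := by rw [← pow_add, Nat.add_sub_cancel' had]
  · rw [flip, ← hl, Nat.mul_div_cancel _ (Nat.two_pow_pos _), ← Nat.xor_assoc, Nat.xor_self,
      Nat.zero_xor]

/-! ### Levels and distances -/

/-- The depth of a vertex. -/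
def level (v : Fin (2 ^ (d + 1) - 1)) : ℕ := Nat.log 2 (v + 1)

theorem level_lt_iff (v : Fin (2 ^ (d + 1) - 1)) (k : ℕ) : level v < k ↔ (v : ℕ) + 1 < 2 ^ k :=
  Nat.log_lt_iff_lt_pow one_lt_two (Nat.succ_ne_zero _)

theorem level_le (v : Fin (2 ^ (d + 1) - 1)) : level v ≤ d :=
  Nat.lt_succ_iff.mp ((level_lt_iff v _).mpr (by have := v.2; omega))

theorem adj_iff (u v : Fin (2 ^ (d + 1) - 1)) :
    (binTree d).Adj u v ↔ ((v : ℕ) + 1) / 2 = u + 1 ∨ ((u : ℕ) + 1) / 2 = v + 1 := by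
  simp only [binTree, SimpleGraph.fromRel_adj, ne_eq, Fin.ext_iff]
  omega

theorem level_le_of_adj {u v : Fin (2 ^ (d + 1) - 1)} (h : (binTree d).Adj u v) :
    level v ≤ level u + 1 := by
  rw [adj_iff] at h
  unfold level
  rcases h with h | h
  · rw [← h, Nat.log_div_base]; omega
  · rw [← h, Nat.log_div_base]; omega

theorem level_le_walk {u v : Fin (2 ^ (d + 1) - 1)} (p : (binTree d).Walk u v) :
    level v ≤ level u + p.length := by
  induction p with
  | nil => simp
  | cons h p ih =>
    have := level_le_of_adj h
    rw [SimpleGraph.Walk.length_cons]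
    omega

theorem exists_parent (v : Fin (2 ^ (d + 1) - 1)) (hv : (v : ℕ) ≠ 0) :
    ∃ u : Fin (2 ^ (d + 1) - 1), (u : ℕ) < v ∧ (binTree d).Adj u v ∧ level v = level u + 1 := by
  have hlt := v.2
  have h : ((v : ℕ) + 1) / 2 = (((v : ℕ) + 1) / 2 - 1) + 1 := by omega
  refine ⟨⟨((v : ℕ) + 1) / 2 - 1, by omega⟩, ?_, ?_, ?_⟩
  · change ((v : ℕ) + 1) / 2 - 1 < v
    omega
  · exact (adj_iff _ _).mpr (Or.inl h)
  · have h1 : 1 ≤ Nat.log 2 ((v : ℕ) + 1) := Nat.log_pos one_lt_two (by omega)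
    change Nat.log 2 ((v : ℕ) + 1) = Nat.log 2 (((v : ℕ) + 1) / 2 - 1 + 1) + 1
    rw [← h, Nat.log_div_base]
    omega

theorem exists_walk_root (v : Fin (2 ^ (d + 1) - 1)) :
    ∃ p : (binTree d).Walk (binRoot d) v, p.length = level v := by
  induction hn : (v : ℕ) using Nat.strong_induction_on generalizing v with
  | _ n ih =>
    by_cases hv : (v : ℕ) = 0
    · obtain rfl : binRoot d = v := Fin.ext hv.symm
      exact ⟨.nil, by simp [level, binRoot]⟩
    · obtain ⟨u, hlt, hadj, hlev⟩ := exists_parent v hv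
      obtain ⟨p, hp⟩ := ih u (hn ▸ hlt) u rfl
      exact ⟨p.concat hadj, by rw [SimpleGraph.Walk.length_concat, hp, hlev]⟩

theorem connected (d : ℕ) : (binTree d).Connected :=
  (SimpleGraph.connected_iff_exists_forall_reachable _).mpr
    ⟨binRoot d, fun v => (exists_walk_root v).elim fun p _ => p.reachable⟩

theorem dist_root (v : Fin (2 ^ (d + 1) - 1)) : (binTree d).dist (binRoot d) v = level v := by
  obtain ⟨p, hp⟩ := exists_walk_root v
  obtain ⟨q, hq⟩ := (connected d).exists_walk_length_eq_dist (binRoot d) v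
  have h1 := SimpleGraph.dist_le p
  have h2 := level_le_walk q
  have h3 : level (binRoot d) = 0 := by simp [level, binRoot]
  omega

theorem card_filter_Ico {n a b : ℕ} (hb : b ≤ n) (p : Fin n → Prop) [DecidablePred p]
    (hp : ∀ v, p v ↔ a ≤ (v : ℕ) ∧ (v : ℕ) < b) : (univ.filter p).card = b - a := by
  rw [← Nat.card_Ico, ← card_map Fin.valEmbedding]
  congr 1
  ext x
  simp only [mem_map, mem_filter, mem_univ, true_and, hp, Fin.valEmbedding_apply, mem_Ico]
  exact ⟨by rintro ⟨v, h, rfl⟩; exact h, fun h => ⟨⟨x, h.2.trans_le hb⟩, h, rfl⟩⟩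

theorem card_level {l : ℕ} (hl : l ≤ d) :
    (univ.filter fun v : Fin (2 ^ (d + 1) - 1) => level v = l).card = 2 ^ l := by
  have hle : 2 ^ (l + 1) ≤ 2 ^ (d + 1) := Nat.pow_le_pow_right two_pos (by omega)
  have hpos := Nat.two_pow_pos l
  have hs := pow_succ 2 l
  rw [card_filter_Ico (a := 2 ^ l - 1) (b := 2 ^ (l + 1) - 1) (by omega)]
  · omega
  · intro v
    have h1 := level_lt_iff v l
    have h2 := level_lt_iff v (l + 1)
    omega

/-! ### Automorphisms -/

/-- The vertex map induced by `flip`. -/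
def flipVertex (hm : m < 2 ^ d) (v : Fin (2 ^ (d + 1) - 1)) : Fin (2 ^ (d + 1) - 1) :=
  ⟨flip d m (v + 1) - 1, by
    have h0 := flip_ne_zero hm (Nat.add_one_ne_zero v) (level_le v)
    have h : Nat.log 2 (flip d m (v + 1)) < d + 1 := by
      rw [log_flip hm (Nat.add_one_ne_zero v) (level_le v)]
      exact Nat.lt_succ_of_le (level_le v)
    rw [Nat.log_lt_iff_lt_pow one_lt_two h0] at h
    omega⟩

theorem flipVertex_add_one (hm : m < 2 ^ d) (v : Fin (2 ^ (d + 1) - 1)) :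
    (flipVertex hm v : ℕ) + 1 = flip d m (v + 1) :=
  Nat.sub_add_cancel
    (Nat.one_le_iff_ne_zero.mpr (flip_ne_zero hm (Nat.add_one_ne_zero v) (level_le v)))

theorem level_flipVertex (hm : m < 2 ^ d) (v : Fin (2 ^ (d + 1) - 1)) :
    level (flipVertex hm v) = level v := by
  rw [level, flipVertex_add_one]
  exact log_flip hm (Nat.add_one_ne_zero v) (level_le v)

theorem flipVertex_involutive (hm : m < 2 ^ d) : Function.Involutive (flipVertex hm) := fun v => by
  have h := flipVertex_add_one hm (flipVertex hm v)
  rw [flipVertex_add_one hm v, flip_flip hm (Nat.add_one_ne_zero v) (level_le v)] at h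
  exact Fin.ext (by omega)

theorem flipVertex_adj (hm : m < 2 ^ d) {u v : Fin (2 ^ (d + 1) - 1)}
    (h : (binTree d).Adj u v) : (binTree d).Adj (flipVertex hm u) (flipVertex hm v) := by
  rw [adj_iff] at h ⊢
  simp only [flipVertex_add_one]
  refine h.imp (fun h => ?_) fun h => ?_
  · rw [flip_div_two (by omega) (level_le v), h]
  · rw [flip_div_two (by omega) (level_le u), h]

theorem dist_flipVertex (hm : m < 2 ^ d) (u v : Fin (2 ^ (d + 1) - 1)) :
    (binTree d).dist (flipVertex hm u) (flipVertex hm v) = (binTree d).dist u v := by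
  have key : ∀ u v, (binTree d).dist (flipVertex hm u) (flipVertex hm v) ≤ (binTree d).dist u v := by
    intro u v
    obtain ⟨p, hp⟩ := (connected d).exists_walk_length_eq_dist u v
    let f : binTree d →g binTree d := ⟨flipVertex hm, flipVertex_adj hm⟩
    rw [← hp, ← SimpleGraph.Walk.length_map f p]
    exact SimpleGraph.dist_le _
  refine le_antisymm (key u v) ?_
  have h := key (flipVertex hm u) (flipVertex hm v)
  rwa [flipVertex_involutive hm u, flipVertex_involutive hm v] at h

theorem mrep_eq_of_level_eq {S : Finset (Fin (2 ^ (d + 1) - 1))} {j : ℕ}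
    (hS : ∀ v, v ∈ S ↔ level v < j) {u v : Fin (2 ^ (d + 1) - 1)} (h : level u = level v) :
    mrep (binTree d) S v = mrep (binTree d) S u := by
  obtain ⟨m, hm, hmv⟩ :=
    exists_flip_eq (Nat.add_one_ne_zero (u : ℕ)) (Nat.add_one_ne_zero (v : ℕ)) (level_le u) h
  obtain rfl : flipVertex hm u = v := by
    have := flipVertex_add_one hm u
    exact Fin.ext (by omega)
  have hmap : S.map (flipVertex_involutive hm).toPerm.toEmbedding = S := by
    ext x
    rw [mem_map_equiv, hS, hS]
    exact iff_of_eq (congrArg (· < j) (level_flipVertex hm x))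
  calc mrep (binTree d) S (flipVertex hm u)
      = mrep (binTree d) (S.map (flipVertex_involutive hm).toPerm.toEmbedding)
          (flipVertex hm u) := by rw [hmap]
    _ = mrep (binTree d) S u := by
        rw [mrep, map_val, Multiset.map_map]
        exact Multiset.map_congr rfl fun s _ => dist_flipVertex hm u s

theorem level_eq_of_mrep_eq {S : Finset (Fin (2 ^ (d + 1) - 1))} {j : ℕ} (hj : 1 ≤ j)
    (hS : ∀ v, v ∈ S ↔ level v < j) {u v : Fin (2 ^ (d + 1) - 1)} (hu : level u = j)
    (hv : v ∉ S) (h : mrep (binTree d) S v = mrep (binTree d) S u) : level v = j := by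
  have hu0 : (u : ℕ) ≠ 0 := fun h0 => by simp [level, h0] at hu; omega
  obtain ⟨w, -, hadj, hlev⟩ := exists_parent u hu0
  have h1 : 1 ∈ mrep (binTree d) S u :=
    Multiset.mem_map.mpr ⟨w, (hS w).mpr (by omega), SimpleGraph.dist_eq_one_iff_adj.mpr hadj.symm⟩
  rw [← h] at h1
  obtain ⟨s, hs, hd⟩ := Multiset.mem_map.mp h1
  have h2 := level_le_of_adj (SimpleGraph.dist_eq_one_iff_adj.mp hd).symm
  have h3 := (hS s).mp hs
  rw [hS] at hv
  omega

theorem mem_mclass {V : Type*} [Fintype V] (G : SimpleGraph V) (S : Finset V) (u v : V) :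
    v ∈ mclass G S u ↔ v ∉ S ∧ mrep G S v = mrep G S u := by
  simp [mclass]

end BinTree

open scoped Classical in
/-- for `d ≥ 2` and `1 ≤ j ≤ d`, the set `S` of all vertices of the complete
binary tree `T_d` at distance at most `j - 1` from the root is a `2^j`-multiset
antiresolving set of `T_d` of cardinality `2^j - 1`; in particular
`msad_{2^j}(T_d) ≤ 2^j - 1`. -/
theorem stmt18 (d j : ℕ) (hd : 2 ≤ d) (hj1 : 1 ≤ j) (hjd : j ≤ d)
    (S : Finset (Fin (2 ^ (d + 1) - 1)))
    (hS : S = Finset.univ.filter (fun v => (binTree d).dist (binRoot d) v ≤ j - 1)) :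
    IsMARS (binTree d) S (2 ^ j) ∧ S.card = 2 ^ j - 1 := by
  have hmem : ∀ v, v ∈ S ↔ BinTree.level v < j := by
    intro v
    rw [hS, mem_filter, BinTree.dist_root]
    simp only [mem_univ, true_and]
    omega
  have hle : 2 ^ j ≤ 2 ^ (d + 1) := Nat.pow_le_pow_right two_pos (by omega)
  obtain ⟨u, hu⟩ : ∃ u : Fin (2 ^ (d + 1) - 1), BinTree.level u = j := by
    have h : 0 < (univ.filter fun v : Fin (2 ^ (d + 1) - 1) => BinTree.level v = j).card := by
      rw [BinTree.card_level hjd]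
      exact Nat.two_pow_pos j
    obtain ⟨u, hu⟩ := card_pos.mp h
    exact ⟨u, (mem_filter.mp hu).2⟩
  have huS : u ∉ S := by rw [hmem]; omega
  have hge : ∀ u ∉ S, 2 ^ j ≤ (mclass (binTree d) S u).card := by
    intro u hu
    rw [hmem, not_lt] at hu
    calc 2 ^ j ≤ 2 ^ BinTree.level u := Nat.pow_le_pow_right two_pos hu
      _ = _ := (BinTree.card_level (BinTree.level_le u)).symm
      _ ≤ _ := card_le_card fun v hv => by
        have hv' := (mem_filter.mp hv).2
        refine (BinTree.mem_mclass _ _ _ _).mpr ⟨?_, BinTree.mrep_eq_of_level_eq hmem hv'.symm⟩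
        rw [hmem]
        omega
  refine ⟨⟨?_, ⟨u, by simpa using huS⟩, hge, u, huS, le_antisymm ?_ (hge u huS)⟩, ?_⟩
  · refine ⟨binRoot d, (hmem _).mpr ?_⟩
    rw [← BinTree.dist_root, SimpleGraph.dist_self]
    omega
  · rw [← BinTree.card_level hjd]
    refine card_le_card fun v hv => ?_
    obtain ⟨hvS, hv⟩ := (BinTree.mem_mclass _ _ _ _).mp hv
    exact mem_filter.mpr ⟨mem_univ v, BinTree.level_eq_of_mrep_eq hj1 hmem hu hvS hv⟩
  · rw [hS]
    rw [BinTree.card_filter_Ico (a := 0) (b := 2 ^ j - 1) (by omega), Nat.sub_zero]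
    intro v
    rw [BinTree.dist_root]
    have := BinTree.level_lt_iff v j
    omega
end

section
/- Let d ≥ 2 be an integer and let T_d be the complete binary tree of height d. Then: (a) if d = 2, T_d contains no 3-multiset antiresolving set; (b) if d = 3, then msad_3(T_d) = 2; (c) if d > 3, then msad_3(T_d) = 1, i.e., T_d has a 3-multiset antiresolving set consisting of a single vertex. -/
open Finset

/-- `msad_k(G) = m`: `G` has a `k`-multiset antiresolving set of cardinality `m`, and every
`k`-multiset antiresolving set of `G` has cardinality at least `m`. -/
def MsadEq {V : Type*} [Fintype V] (G : SimpleGraph V) (k m : ℕ) : Prop :=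
  (∃ S : Finset V, IsMARS G S k ∧ S.card = m) ∧
    ∀ S : Finset V, IsMARS G S k → m ≤ S.card

/-- A function on the vertices that vanishes at `b`, changes by at most one along edges and can
be decreased by one at every vertex other than `b` is the distance to `b`. -/
theorem dist_eq_of_potential {V : Type*} (G : SimpleGraph V) (f : V → ℕ) (b : V)
    (hb : f b = 0) (hlip : ∀ u v, G.Adj u v → f u ≤ f v + 1)
    (hdesc : ∀ v, v ≠ b → ∃ w, G.Adj v w ∧ f v = f w + 1) (v : V) : G.dist v b = f v := by
  have upper : ∀ n v, f v = n → ∃ p : G.Walk v b, p.length = n := by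
    intro n
    induction n with
    | zero =>
      intro v hv
      by_cases h : v = b
      · subst h
        exact ⟨.nil, rfl⟩
      · obtain ⟨w, -, hw⟩ := hdesc v h
        omega
    | succ n ih =>
      intro v hv
      obtain ⟨w, hvw, hw⟩ := hdesc v (by rintro rfl; omega)
      obtain ⟨p, hp⟩ := ih w (by omega)
      exact ⟨.cons hvw p, by simp [hp]⟩
  have lower : ∀ {u w : V} (p : G.Walk u w), f u ≤ p.length + f w := by
    intro u w p
    induction p with
    | nil => simp
    | cons h p ih =>
      have := hlip _ _ h
      simp only [SimpleGraph.Walk.length_cons]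
      omega
  obtain ⟨p, hp⟩ := upper _ v rfl
  obtain ⟨q, hq⟩ := p.reachable.exists_walk_length_eq_dist
  have h₁ := lower q
  have h₂ := SimpleGraph.dist_le p
  omega

/-- Distance in the infinite binary tree on the positive integers, in which the parent of `a`
is `a / 2`, computed with the recursion depth bounded by the first argument. -/
def heapDistAux : ℕ → ℕ → ℕ → ℕ
  | 0, _, _ => 0
  | k + 1, a, b =>
    if a = b then 0
    else if b < a then heapDistAux k (a / 2) b + 1
    else heapDistAux k a (b / 2) + 1

/-- Distance in the infinite binary tree on the positive integers, in which the parent of `a`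
is `a / 2`. -/
def heapDist (a b : ℕ) : ℕ := heapDistAux (a + b) a b

theorem heapDistAux_eq_of_le (k l a b : ℕ) (hk : a + b ≤ k) (hl : a + b ≤ l) :
    heapDistAux k a b = heapDistAux l a b := by
  induction k generalizing l a b with
  | zero =>
    obtain ⟨rfl, rfl⟩ : a = 0 ∧ b = 0 := by omega
    cases l <;> simp [heapDistAux]
  | succ k ih =>
    cases l with
    | zero =>
      obtain ⟨rfl, rfl⟩ : a = 0 ∧ b = 0 := by omega
      simp [heapDistAux]
    | succ l =>
      simp only [heapDistAux]
      split_ifs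
      · rfl
      · rw [ih l (a / 2) b (by omega) (by omega)]
      · rw [ih l a (b / 2) (by omega) (by omega)]

theorem heapDist_self (a : ℕ) : heapDist a a = 0 := by
  unfold heapDist
  cases a + a <;> simp [heapDistAux]

theorem heapDist_of_gt {a b : ℕ} (h : b < a) : heapDist a b = heapDist (a / 2) b + 1 := by
  unfold heapDist
  rw [heapDistAux_eq_of_le (a / 2 + b) (a + b - 1) _ _ (by omega) (by omega)]
  obtain ⟨k, hk⟩ : ∃ k, a + b = k + 1 := ⟨a + b - 1, by omega⟩
  simp [hk, heapDistAux, h, h.ne']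

theorem heapDist_of_lt {a b : ℕ} (h : a < b) : heapDist a b = heapDist a (b / 2) + 1 := by
  unfold heapDist
  rw [heapDistAux_eq_of_le (a + b / 2) (a + b - 1) _ _ (by omega) (by omega)]
  obtain ⟨k, hk⟩ : ∃ k, a + b = k + 1 := ⟨a + b - 1, by omega⟩
  simp [hk, heapDistAux, h.ne, h.not_gt]

/-- Moving to the parent changes the distance by at most one. -/
theorem heapDist_half_le (a b : ℕ) (ha : 2 ≤ a) :
    heapDist (a / 2) b ≤ heapDist a b + 1 ∧ heapDist a b ≤ heapDist (a / 2) b + 1 := by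
  induction b using Nat.strong_induction_on with
  | _ b ih =>
    rcases lt_trichotomy a b with h | rfl | h
    · rw [heapDist_of_lt h, heapDist_of_lt (show a / 2 < b by omega)]
      have := ih (b / 2) (by omega)
      omega
    · rw [heapDist_self, heapDist_of_lt (show a / 2 < a by omega), heapDist_self]
      omega
    · rw [heapDist_of_gt h]
      omega

/-- From every vertex other than `b`, either the parent or a child that is at most `b` is closer
to `b`. -/
theorem exists_neighbor_heapDist (a b : ℕ) (ha : 1 ≤ a) (hb : 1 ≤ b) (hab : a ≠ b) :
    (2 ≤ a ∧ heapDist a b = heapDist (a / 2) b + 1) ∨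
      ∃ c, c / 2 = a ∧ c ≤ b ∧ heapDist a b = heapDist c b + 1 := by
  induction b using Nat.strong_induction_on with
  | _ b ih =>
    rcases lt_or_gt_of_ne hab with h | h
    · by_cases hb : a = b / 2
      · right
        refine ⟨b, hb.symm, le_rfl, ?_⟩
        rw [heapDist_of_lt h, ← hb, heapDist_self, heapDist_self]
      · rcases ih (b / 2) (by omega) (by omega) hb with ⟨h₂, h₃⟩ | ⟨c, h₂, h₃, h₄⟩
        · left
          rw [heapDist_of_lt h, heapDist_of_lt (show a / 2 < b by omega), h₃]
          exact ⟨h₂, rfl⟩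
        · right
          refine ⟨c, h₂, by omega, ?_⟩
          rw [heapDist_of_lt h, heapDist_of_lt (show c < b by omega), h₄]
    · exact Or.inl ⟨by omega, heapDist_of_gt h⟩

theorem binTree_adj_iff {d : ℕ} (u v : Fin (2 ^ (d + 1) - 1)) :
    (binTree d).Adj u v ↔
      ((v : ℕ) + 1) / 2 = (u : ℕ) + 1 ∨ ((u : ℕ) + 1) / 2 = (v : ℕ) + 1 := by
  simp only [binTree, SimpleGraph.fromRel_adj, ne_eq, Fin.ext_iff]
  omega

theorem binTree_dist {d : ℕ} (u v : Fin (2 ^ (d + 1) - 1)) :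
    (binTree d).dist u v = heapDist (u + 1) (v + 1) := by
  refine dist_eq_of_potential (binTree d) (fun u => heapDist (u + 1) (v + 1)) v
    (heapDist_self _) ?_ ?_ u
  · intro x y hxy
    rcases (binTree_adj_iff x y).1 hxy with h | h
    · simpa only [h] using (heapDist_half_le (y + 1) (v + 1) (by omega)).1
    · simpa only [h] using (heapDist_half_le (x + 1) (v + 1) (by omega)).2
  · intro x hx
    rcases exists_neighbor_heapDist (x + 1) (v + 1) (by omega) (by omega)
      (by rw [ne_eq, Fin.ext_iff] at hx; omega) with ⟨h₁, h₂⟩ | ⟨c, h₁, h₂, h₃⟩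
    · have h₄ : ((x : ℕ) + 1) / 2 - 1 + 1 = (x + 1) / 2 := by omega
      refine ⟨⟨(x + 1) / 2 - 1, by omega⟩, (binTree_adj_iff _ _).2 (Or.inr h₄.symm), ?_⟩
      simpa only [h₄] using h₂
    · have h₄ : c - 1 + 1 = c := by omega
      refine ⟨⟨c - 1, by omega⟩, (binTree_adj_iff _ _).2 (Or.inl ?_), ?_⟩
      · simpa only [h₄] using h₁
      · simpa only [h₄] using h₃

/-- A computable form of `mclass` for subsets of the complete binary tree. -/
def heapClass {n : ℕ} (S : Finset (Fin n)) (u : Fin n) : Finset (Fin n) :=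
  univ.filter fun v => v ∉ S ∧
    S.val.map (fun s : Fin n => heapDist (v + 1) (s + 1)) =
      S.val.map (fun s : Fin n => heapDist (u + 1) (s + 1))

theorem mclass_binTree {d : ℕ} (S : Finset (Fin (2 ^ (d + 1) - 1)))
    (u : Fin (2 ^ (d + 1) - 1)) : mclass (binTree d) S u = heapClass S u := by
  ext v
  simp [mclass, heapClass, mrep, binTree_dist]

theorem isMARS_binTree_iff {d k : ℕ} (S : Finset (Fin (2 ^ (d + 1) - 1))) :
    IsMARS (binTree d) S k ↔ S.Nonempty ∧ Sᶜ.Nonempty ∧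
      (∀ u ∉ S, k ≤ (heapClass S u).card) ∧ ∃ u ∉ S, (heapClass S u).card = k := by
  simp only [IsMARS, mclass_binTree]
  congr!

theorem not_isMARS_binTree_two (S : Finset (Fin (2 ^ (2 + 1) - 1))) :
    ¬ IsMARS (binTree 2) S 3 := by
  rw [isMARS_binTree_iff]
  revert S
  decide +kernel

theorem msadEq_binTree_three : MsadEq (binTree 3) 3 2 := by
  refine ⟨⟨{⟨0, by norm_num⟩, ⟨1, by norm_num⟩}, ?_, card_pair (by simp)⟩, fun S hS => ?_⟩
  · rw [isMARS_binTree_iff]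
    decide +kernel
  · by_contra! h
    obtain ⟨s, rfl⟩ := card_eq_one.1 (show S.card = 1 by have := hS.1.card_pos; omega)
    rw [isMARS_binTree_iff] at hS
    revert s
    decide +kernel

theorem mem_heapClass_singleton {n : ℕ} (s u v : Fin n) :
    v ∈ heapClass {s} u ↔ v ≠ s ∧ heapDist (v + 1) (s + 1) = heapDist (u + 1) (s + 1) := by
  simp [heapClass]

theorem heapDist_two_eq_zero_iff {a : ℕ} (ha : 1 ≤ a) : heapDist a 2 = 0 ↔ a = 2 := by
  refine ⟨fun h => ?_, by rintro rfl; rfl⟩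
  by_contra hne
  rcases exists_neighbor_heapDist a 2 ha (by norm_num) hne with ⟨-, h'⟩ | ⟨c, -, -, h'⟩ <;> omega

theorem heapDist_two_eq_one_iff {a : ℕ} (ha : 1 ≤ a) :
    heapDist a 2 = 1 ↔ a = 1 ∨ a = 4 ∨ a = 5 := by
  rcases lt_or_ge 2 a with h | h
  · rw [heapDist_of_gt h]
    have := heapDist_two_eq_zero_iff (a := a / 2) (by omega)
    omega
  · interval_cases a <;> decide

/-- In a complete binary tree of height at least four, every positive distance to a fixed child of
the root that occurs at all occurs at least three times. -/
theorem exists_three_heapDist_two {d a : ℕ} (hd : 3 < d) (ha : 1 ≤ a) (ha' : a < 2 ^ (d + 1))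
    (h2 : a ≠ 2) : ∃ x y z, 1 ≤ x ∧ x < y ∧ y < z ∧ z < 2 ^ (d + 1) ∧
      x ≠ 2 ∧ y ≠ 2 ∧ z ≠ 2 ∧ heapDist x 2 = heapDist a 2 ∧ heapDist y 2 = heapDist a 2 ∧
      heapDist z 2 = heapDist a 2 := by
  have hpow : 32 ≤ 2 ^ (d + 1) := Nat.pow_le_pow_right (n := 2) (i := 5) (by norm_num) (by omega)
  rcases Nat.lt_or_ge a 8 with h | h
  · interval_cases a
    · exact ⟨1, 4, 5, by omega, by omega, by omega, by omega, by decide⟩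
    · exact absurd rfl h2
    · exact ⟨3, 8, 9, by omega, by omega, by omega, by omega, by decide⟩
    · exact ⟨1, 4, 5, by omega, by omega, by omega, by omega, by decide⟩
    · exact ⟨1, 4, 5, by omega, by omega, by omega, by omega, by decide⟩
    · exact ⟨6, 7, 16, by omega, by omega, by omega, by omega, by decide⟩
    · exact ⟨6, 7, 16, by omega, by omega, by omega, by omega, by decide⟩
  · have key : ∀ x, x / 4 = a / 4 → heapDist x 2 = heapDist a 2 := by
      intro x hx
      rw [heapDist_of_gt (show 2 < x by omega), heapDist_of_gt (show 2 < x / 2 by omega),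
        heapDist_of_gt (show 2 < a by omega), heapDist_of_gt (show 2 < a / 2 by omega),
        Nat.div_div_eq_div_mul, Nat.div_div_eq_div_mul, hx]
    have hd' : 2 ^ (d + 1) = 4 * 2 ^ (d - 1) := by
      rw [show d + 1 = 2 + (d - 1) by omega, pow_add]
      norm_num
    exact ⟨4 * (a / 4), 4 * (a / 4) + 1, 4 * (a / 4) + 2, by omega, by omega, by omega, by omega,
      by omega, by omega, by omega, key _ (by omega), key _ (by omega), key _ (by omega)⟩

/-- A child of the root of a complete binary tree of height at least four is a `3`-MARS. -/
theorem isMARS_binTree_singleton {d : ℕ} (hd : 3 < d) (s : Fin (2 ^ (d + 1) - 1))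
    (hs : (s : ℕ) = 1) : IsMARS (binTree d) {s} 3 := by
  have hpow : 32 ≤ 2 ^ (d + 1) := Nat.pow_le_pow_right (n := 2) (i := 5) (by norm_num) (by omega)
  have hne : (⟨0, by omega⟩ : Fin (2 ^ (d + 1) - 1)) ∉ ({s} : Finset _) := by
    simp [Fin.ext_iff, hs]
  rw [isMARS_binTree_iff]
  refine ⟨singleton_nonempty s, ⟨_, mem_compl.2 hne⟩, fun u hu => ?_, _, hne, ?_⟩
  · obtain ⟨x, y, z, h₁, hxy, hyz, hz, hx', hy', hz', hx, hy, hz''⟩ :=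
      exists_three_heapDist_two (a := u + 1) hd (by omega) (by omega)
        (by rw [mem_singleton, Fin.ext_iff] at hu; omega)
    refine (two_lt_card).2 ⟨⟨x - 1, by omega⟩, ?_, ⟨y - 1, by omega⟩, ?_, ⟨z - 1, by omega⟩, ?_,
      by simp only [ne_eq, Fin.mk.injEq]; omega, by simp only [ne_eq, Fin.mk.injEq]; omega,
      by simp only [ne_eq, Fin.mk.injEq]; omega⟩ <;>
    rw [mem_heapClass_singleton, ne_eq, Fin.ext_iff, hs] <;>
    refine ⟨by dsimp only; omega, ?_⟩
    · rwa [Nat.sub_add_cancel (by omega)]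
    · rwa [Nat.sub_add_cancel (by omega)]
    · rwa [Nat.sub_add_cancel (by omega)]
  · rw [card_eq_three]
    refine ⟨⟨0, by omega⟩, ⟨3, by omega⟩, ⟨4, by omega⟩, by simp, by simp, by simp, ?_⟩
    ext v
    rw [mem_heapClass_singleton, hs]
    have h₁ : heapDist (0 + 1) (1 + 1) = 1 := by decide
    have h₂ := heapDist_two_eq_one_iff (a := v + 1) (by omega)
    simp only [h₁, mem_insert, mem_singleton, Fin.ext_iff, ne_eq, hs, h₂]
    omega

/-- for the complete binary tree `T_d` of height `d ≥ 2`: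
(a) if `d = 2` then `T_d` has no `3`-multiset antiresolving set;
(b) if `d = 3` then `msad_3(T_d) = 2`;
(c) if `d > 3` then `msad_3(T_d) = 1`. -/
theorem stmt19 (d : ℕ) (hd : 2 ≤ d) :
    (d = 2 → ∀ S : Finset (Fin (2 ^ (d + 1) - 1)), ¬ IsMARS (binTree d) S 3) ∧
    (d = 3 → MsadEq (binTree d) 3 2) ∧
    (3 < d → MsadEq (binTree d) 3 1) := by
  refine ⟨?_, ?_, fun h => ?_⟩
  · rintro rfl
    exact not_isMARS_binTree_two
  · rintro rfl
    exact msadEq_binTree_three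
  · have hpow : 2 < 2 ^ (d + 1) - 1 := by
      have : 2 ^ 2 ≤ 2 ^ (d + 1) := Nat.pow_le_pow_right (by norm_num) (by omega)
      omega
    exact ⟨⟨{⟨1, by omega⟩}, isMARS_binTree_singleton h _ rfl, card_singleton _⟩,
      fun S hS => hS.1.card_pos⟩
end
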